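/- arXiv:1611.04660 — 2 statements merged into one kernel-verified Lean document; each statement's English description precedes it below -/
import Mathlib

section
/- Let D be a dataset (a finite list of transactions, each transaction a subset of a finite set of items), let θ > 0 be a minimum support threshold, let S and X be disjoint itemsets, and say the pair (X, S) satisfies the Potential Outcome Support condition if support(S ∪ X) > θ and, for every x ∈ X, support(S, X_{-x}) > θ. Then the Potential Outcome Support condition is antimonotonic: if (X, S) fails the condition, then for every item x' not in X ∪ S the extended pair (X ∪ {x'}, S) also fails the condition. -/
/-- The support of an itemset `I` in a dataset `D` (a finite list of transactions):
the fraction of transactions of `D` that contain every item of `I`. -/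
def support {α : Type*} [DecidableEq α] (D : List (Finset α)) (I : Finset α) : ℚ :=
  (D.countP (fun t => decide (I ⊆ t))) / D.length

/-- `supportMinus D S X x`: the fraction of transactions of `D` that contain every item of `S`
and every item of `X \ {x}` but do NOT contain `x`.  (Written `support(S, X_{-x})`.) -/
def supportMinus {α : Type*} [DecidableEq α] (D : List (Finset α)) (S X : Finset α) (x : α) : ℚ :=
  (D.countP (fun t => decide (S ⊆ t ∧ X.erase x ⊆ t ∧ x ∉ t))) / D.length

/-- The pair `(X, S)` satisfies the Potential Outcome Support condition at threshold `θ`: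
`support (S ∪ X) > θ` and for every `x ∈ X`, `support(S, X_{-x}) > θ`. -/
def PotentialOutcomeSupport {α : Type*} [DecidableEq α] (D : List (Finset α)) (θ : ℚ)
    (S X : Finset α) : Prop :=
  θ < support D (S ∪ X) ∧ ∀ x ∈ X, θ < supportMinus D S X x

/-- **Potential Outcome Support Pruning is antimonotonic**: if the pair `(X, S)` of disjoint
itemsets fails the Potential Outcome Support condition, then for every item `x'` not in
`X ∪ S`, the extended pair `(X ∪ {x'}, S)` also fails the condition. -/
theorem potentialOutcomeSupport_antimonotone {α : Type*} [DecidableEq α]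
    (D : List (Finset α)) (θ : ℚ) (hθ : 0 < θ) (S X : Finset α) (hdisj : Disjoint S X)
    (hfail : ¬ PotentialOutcomeSupport D θ S X) :
    ∀ x' : α, x' ∉ X ∪ S → ¬ PotentialOutcomeSupport D θ S (insert x' X) := by
  intro x' _ h
  apply hfail
  obtain ⟨h1, h2⟩ := h
  refine ⟨lt_of_lt_of_le h1 ?_, fun x hx => lt_of_lt_of_le (h2 x (Finset.mem_insert_of_mem hx)) ?_⟩
  · unfold support
    gcongr ?_ / _
    refine Nat.cast_le.mpr (List.countP_mono_left ?_)
    intro t _ ht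
    rw [decide_eq_true_eq] at ht ⊢
    exact (Finset.union_subset_union_right (Finset.subset_insert x' X)).trans ht
  · unfold supportMinus
    gcongr ?_ / _
    refine Nat.cast_le.mpr (List.countP_mono_left ?_)
    intro t _ ht
    rw [decide_eq_true_eq] at ht ⊢
    exact ⟨ht.1, (Finset.erase_subset_erase x (Finset.subset_insert x' X)).trans ht.2.1, ht.2.2⟩
end

section
/- Let μ be a probability measure on a measurable space Ω, let X and Y be measurable events, let Z₁, …, Zₘ and U₁, …, Uₙ be two finite measurable partitions of Ω, and assume μ(X ∩ Uⱼ ∩ Zₖ) > 0 and μ(Xᶜ ∩ Uⱼ ∩ Zₖ) > 0 for all j, k. If Y is conditionally independent of each Uⱼ given X and Zₖ and given Xᶜ and Zₖ (i.e., μ(Y | X ∩ Uⱼ ∩ Zₖ) = μ(Y | X ∩ Zₖ) and μ(Y | Xᶜ ∩ Uⱼ ∩ Zₖ) = μ(Y | Xᶜ ∩ Zₖ) for all j, k), then the doubly stratified effect collapses to the Z-stratified effect: ∑ⱼ ∑ₖ μ(Uⱼ ∩ Zₖ) · ( μ(Y | X ∩ Uⱼ ∩ Zₖ) − μ(Y |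 Xᶜ ∩ Uⱼ ∩ Zₖ) ) = ∑ₖ μ(Zₖ) · ( μ(Y | X ∩ Zₖ) − μ(Y | Xᶜ ∩ Zₖ) ). -/
open MeasureTheory

/-- The conditional probability `μ(A | B) = μ(A ∩ B) / μ(B)`, as a real number. -/
noncomputable def condProb {Ω : Type*} [MeasurableSpace Ω] (μ : Measure Ω) (A B : Set Ω) : ℝ :=
  (μ (A ∩ B)).toReal / (μ B).toReal

/-- Let `Z₁, …, Zₘ` and `U₁, …, Uₙ` be two finite measurable partitions of `Ω` with
`μ(X ∩ Uⱼ ∩ Zₖ) > 0` and `μ(Xᶜ ∩ Uⱼ ∩ Zₖ) > 0` for all `j, k`.  If `Y` is conditionally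
independent of each `Uⱼ` given `X` and `Zₖ`, and given `Xᶜ` and `Zₖ`, then the doubly
stratified effect collapses to the `Z`-stratified effect:
`∑ⱼ ∑ₖ μ(Uⱼ ∩ Zₖ)·(μ(Y | X ∩ Uⱼ ∩ Zₖ) − μ(Y | Xᶜ ∩ Uⱼ ∩ Zₖ))
  = ∑ₖ μ(Zₖ)·(μ(Y | X ∩ Zₖ) − μ(Y | Xᶜ ∩ Zₖ))`. -/
theorem double_stratified_collapse {Ω : Type*} [MeasurableSpace Ω]
    (μ : Measure Ω) [IsProbabilityMeasure μ] (X Y : Set Ω)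
    (hX : MeasurableSet X) (hY : MeasurableSet Y)
    {m n : ℕ} (Z : Fin m → Set Ω) (U : Fin n → Set Ω)
    (hZmeas : ∀ k, MeasurableSet (Z k)) (hUmeas : ∀ j, MeasurableSet (U j))
    (hZdisj : Pairwise (Function.onFun Disjoint Z)) (hZcover : (⋃ k, Z k) = Set.univ)
    (hUdisj : Pairwise (Function.onFun Disjoint U)) (hUcover : (⋃ j, U j) = Set.univ)
    (hposX : ∀ j k, 0 < μ (X ∩ U j ∩ Z k)) (hposXc : ∀ j k, 0 < μ (Xᶜ ∩ U j ∩ Z k))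
    (hciX : ∀ j k, condProb μ Y (X ∩ U j ∩ Z k) = condProb μ Y (X ∩ Z k))
    (hciXc : ∀ j k, condProb μ Y (Xᶜ ∩ U j ∩ Z k) = condProb μ Y (Xᶜ ∩ Z k)) :
    ∑ j, ∑ k, (μ (U j ∩ Z k)).toReal *
        (condProb μ Y (X ∩ U j ∩ Z k) - condProb μ Y (Xᶜ ∩ U j ∩ Z k)) =
      ∑ k, (μ (Z k)).toReal * (condProb μ Y (X ∩ Z k) - condProb μ Y (Xᶜ ∩ Z k)) := by
  have key : ∀ k, (μ (Z k)).toReal = ∑ j, (μ (U j ∩ Z k)).toReal := by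
    intro k
    have h1 : Z k = ⋃ j, (U j ∩ Z k) := by
      rw [← Set.iUnion_inter, hUcover, Set.univ_inter]
    have h2 : μ (Z k) = ∑ j, μ (U j ∩ Z k) := by
      conv_lhs => rw [h1]
      rw [measure_iUnion (fun i j hij => (hUdisj hij).mono Set.inter_subset_left
        Set.inter_subset_left) (fun j => (hUmeas j).inter (hZmeas k)), tsum_fintype]
    rw [h2, ENNReal.toReal_sum (fun j _ => measure_ne_top μ _)]
  rw [Finset.sum_comm]
  refine Finset.sum_congr rfl fun k _ => ?_
  rw [key k, Finset.sum_mul]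
  refine Finset.sum_congr rfl fun j _ => ?_
  rw [hciX, hciXc]
end
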